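/- Let (H, μ, Δ, α_H, R) be a quasitriangular Hom-bialgebra with α_H bijective and (α_H⊗α_H)(R) = R, and let (M, α_M), (N, α_N), (P, α_P) be left H-modules with bijective structure maps. Define c_{X,Y}: X⊗Y → Y⊗X by c_{X,Y}(x⊗y) = α_Y^{-1}(R²·y)⊗α_X^{-1}(R¹·x) and associators a_{X,Y,Z}((x⊗y)⊗z) = α_X^{-1}(x)⊗(y⊗α_Z(z)), where tensor products of modules carry the action h·(x⊗y) = h₁·x⊗h₂·y. Then (α_N⊗α_M)∘c_{M,N} = c_{M,N}∘(α_M⊗α_N), c_{M,N} is a morphism of left H-modules, the braid relation (id_P⊗c_{M,N})∘(c_{M,P}⊗id_N)∘(id_M⊗c_{N,P}) = (c_{N,P}⊗id_M)∘(id_N⊗c_{M,P})∘(c_{M,N}⊗id_P) holds, and the two hexagon relations hold: a_{N,P,M}∘c_{M,N⊗P}∘a_{M,N,P} = (id_N⊗c_{M,P})∘a_{N,M,P}∘(c_{M,N}⊗id_P) and a_{P,M,N}^{-1}∘c_{M⊗N,P}∘a_{M,N,P}^{-1} = (c_{M,P}⊗id_N)∘a_{M,P,N}^{-1}∘(id_M⊗c_{N,P}).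 -/

import Mathlib

open TensorProduct

noncomputable section

namespace HomYD

variable (k : Type*) [Field k]
variable {H M N : Type*}
variable [AddCommGroup H] [Module k H]
variable [AddCommGroup M] [Module k M]
variable [AddCommGroup N] [Module k N]

/-- Rearrangement `(a ⊗ b) ⊗ c ↦ (a ⊗ c) ⊗ b`. -/
def rearr (A B C : Type*) [AddCommGroup A] [Module k A] [AddCommGroup B] [Module k B]
    [AddCommGroup C] [Module k C] :
    (A ⊗[k] B) ⊗[k] C →ₗ[k] (A ⊗[k] C) ⊗[k] B :=
  (TensorProduct.assoc k A C B).symm.toLinearMap ∘ₗ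
    (TensorProduct.map LinearMap.id (TensorProduct.comm k B C).toLinearMap) ∘ₗ
      (TensorProduct.assoc k A B C).toLinearMap

/-- Middle-four exchange `(a ⊗ b) ⊗ (c ⊗ d) ↦ (a ⊗ c) ⊗ (b ⊗ d)`. -/
def ttc (A B C D : Type*) [AddCommGroup A] [Module k A] [AddCommGroup B] [Module k B]
    [AddCommGroup C] [Module k C] [AddCommGroup D] [Module k D] :
    (A ⊗[k] B) ⊗[k] (C ⊗[k] D) →ₗ[k] (A ⊗[k] C) ⊗[k] (B ⊗[k] D) :=
  (TensorProduct.tensorTensorTensorComm k A B C D).toLinearMap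

/-- Hom-bialgebra (no unit/counit): multiplicativity of `α`, Hom-associativity,
comultiplicativity of `α`, Hom-coassociativity, and `Δ` multiplicative. -/
structure IsHomBialgebra (μ : H ⊗[k] H →ₗ[k] H) (Δ : H →ₗ[k] H ⊗[k] H)
    (α : H →ₗ[k] H) : Prop where
  mul_mult : ∀ a b : H, α (μ (a ⊗ₜ[k] b)) = μ (α a ⊗ₜ[k] α b)
  hom_assoc : ∀ a b c : H, μ (α a ⊗ₜ[k] μ (b ⊗ₜ[k] c)) = μ (μ (a ⊗ₜ[k] b) ⊗ₜ[k] α c)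
  comul_compat : TensorProduct.map α α ∘ₗ Δ = Δ ∘ₗ α
  hom_coassoc : (TensorProduct.assoc k H H H).toLinearMap ∘ₗ TensorProduct.map Δ α ∘ₗ Δ
      = TensorProduct.map α Δ ∘ₗ Δ
  comul_mul : Δ ∘ₗ μ
      = TensorProduct.map μ μ ∘ₗ ttc k H H H H ∘ₗ TensorProduct.map Δ Δ

/-- Left module over a Hom-(bi)algebra. -/
structure IsHomModule (μ : H ⊗[k] H →ₗ[k] H) (α : H →ₗ[k] H)
    (ρ : H ⊗[k] M →ₗ[k] M) (αM : M →ₗ[k] M) : Prop where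
  str_compat : ∀ (h : H) (m : M), αM (ρ (h ⊗ₜ[k] m)) = ρ (α h ⊗ₜ[k] αM m)
  hom_smul : ∀ (h h' : H) (m : M),
      ρ (α h ⊗ₜ[k] ρ (h' ⊗ₜ[k] m)) = ρ (μ (h ⊗ₜ[k] h') ⊗ₜ[k] αM m)

/-- Left comodule over a Hom-(bi)algebra. -/
structure IsHomComodule (Δ : H →ₗ[k] H ⊗[k] H) (α : H →ₗ[k] H)
    (lM : M →ₗ[k] H ⊗[k] M) (αM : M →ₗ[k] M) : Prop where
  str_compat : TensorProduct.map α αM ∘ₗ lM = lM ∘ₗ αM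
  hom_coact : TensorProduct.map Δ αM ∘ₗ lM
      = (TensorProduct.assoc k H H M).symm.toLinearMap ∘ₗ TensorProduct.map α lM ∘ₗ lM

/-- `h ⊗ m ↦ (h₁·m)₍₋₁₎ β(h₂) ⊗ (h₁·m)₍₀₎`. -/
def ydL (μ : H ⊗[k] H →ₗ[k] H) (Δ : H →ₗ[k] H ⊗[k] H) (β : H →ₗ[k] H)
    (ρ : H ⊗[k] M →ₗ[k] M) (lM : M →ₗ[k] H ⊗[k] M) : H ⊗[k] M →ₗ[k] H ⊗[k] M :=
  TensorProduct.map μ LinearMap.id ∘ₗ rearr k H M H ∘ₗ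
    TensorProduct.map (lM ∘ₗ ρ) β ∘ₗ rearr k H H M ∘ₗ
      TensorProduct.map Δ LinearMap.id

/-- `h ⊗ m ↦ β(h₁) γ(m₍₋₁₎) ⊗ γ(h₂)·m₍₀₎`. -/
def ydR (μ : H ⊗[k] H →ₗ[k] H) (Δ : H →ₗ[k] H ⊗[k] H) (β γ : H →ₗ[k] H)
    (ρ : H ⊗[k] M →ₗ[k] M) (lM : M →ₗ[k] H ⊗[k] M) : H ⊗[k] M →ₗ[k] H ⊗[k] M :=
  TensorProduct.map (μ ∘ₗ TensorProduct.map β γ) (ρ ∘ₗ TensorProduct.map γ LinearMap.id) ∘ₗ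
    ttc k H H H M ∘ₗ TensorProduct.map Δ lM

/-- Yetter-Drinfeld module over a Hom-bialgebra: Hom-module, Hom-comodule and the
compatibility `(h₁·m)₍₋₁₎ α²(h₂) ⊗ (h₁·m)₍₀₎ = α²(h₁) α(m₍₋₁₎) ⊗ α(h₂)·m₍₀₎`. -/
def IsYetterDrinfeld (μ : H ⊗[k] H →ₗ[k] H) (Δ : H →ₗ[k] H ⊗[k] H) (α : H →ₗ[k] H)
    (ρ : H ⊗[k] M →ₗ[k] M) (lM : M →ₗ[k] H ⊗[k] M) (αM : M →ₗ[k] M) : Prop :=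
  IsHomModule k μ α ρ αM ∧ IsHomComodule k Δ α lM αM ∧
    ydL k μ Δ (α ∘ₗ α) ρ lM = ydR k μ Δ (α ∘ₗ α) α ρ lM

/-- `m ⊗ n ↦ αHinv(m₍₋₁₎)·n ⊗ m₍₀₎`. -/
def Bmap (αHinv : H →ₗ[k] H) (lM : M →ₗ[k] H ⊗[k] M) (ρN : H ⊗[k] N →ₗ[k] N) :
    M ⊗[k] N →ₗ[k] N ⊗[k] M :=
  TensorProduct.map (ρN ∘ₗ TensorProduct.map αHinv LinearMap.id) LinearMap.id ∘ₗ
    rearr k H M N ∘ₗ TensorProduct.map lM LinearMap.id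

/-- Quasi-braiding `m ⊗ n ↦ αN⁻¹(αH⁻¹(m₍₋₁₎)·n) ⊗ αM⁻¹(m₍₀₎)`. -/
def braidYD (αH : H ≃ₗ[k] H) (αM : M ≃ₗ[k] M) (αN : N ≃ₗ[k] N)
    (lM : M →ₗ[k] H ⊗[k] M) (ρN : H ⊗[k] N →ₗ[k] N) : M ⊗[k] N →ₗ[k] N ⊗[k] M :=
  TensorProduct.map
      (αN.symm.toLinearMap ∘ₗ ρN ∘ₗ TensorProduct.map αH.symm.toLinearMap LinearMap.id)
      αM.symm.toLinearMap ∘ₗ rearr k H M N ∘ₗ TensorProduct.map lM LinearMap.id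

/-- Action on `M ⊗ N`: `h ⊗ (m ⊗ n) ↦ h₁·m ⊗ h₂·n`. -/
def hatAction (Δ : H →ₗ[k] H ⊗[k] H)
    (ρM : H ⊗[k] M →ₗ[k] M) (ρN : H ⊗[k] N →ₗ[k] N) :
    H ⊗[k] (M ⊗[k] N) →ₗ[k] M ⊗[k] N :=
  TensorProduct.map ρM ρN ∘ₗ ttc k H H M N ∘ₗ TensorProduct.map Δ LinearMap.id

/-- Coaction on `M ⊗ N`: `m ⊗ n ↦ αHinv²(m₍₋₁₎ n₍₋₁₎) ⊗ (m₍₀₎ ⊗ n₍₀₎)`. -/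
def hatCoaction (μ : H ⊗[k] H →ₗ[k] H) (αHinv : H →ₗ[k] H)
    (lM : M →ₗ[k] H ⊗[k] M) (lN : N →ₗ[k] H ⊗[k] N) :
    M ⊗[k] N →ₗ[k] H ⊗[k] (M ⊗[k] N) :=
  TensorProduct.map (αHinv ∘ₗ αHinv ∘ₗ μ) LinearMap.id ∘ₗ ttc k H M H N ∘ₗ
    TensorProduct.map lM lN

/-- Action on `M ⊗ N`: `h ⊗ (m ⊗ n) ↦ αHinv²(h₁)·m ⊗ αHinv²(h₂)·n`. -/
def tildeAction (Δ : H →ₗ[k] H ⊗[k] H) (αHinv : H →ₗ[k] H)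
    (ρM : H ⊗[k] M →ₗ[k] M) (ρN : H ⊗[k] N →ₗ[k] N) :
    H ⊗[k] (M ⊗[k] N) →ₗ[k] M ⊗[k] N :=
  TensorProduct.map ρM ρN ∘ₗ ttc k H H M N ∘ₗ
    TensorProduct.map
      (TensorProduct.map (αHinv ∘ₗ αHinv) (αHinv ∘ₗ αHinv) ∘ₗ Δ) LinearMap.id

/-- Coaction on `M ⊗ N`: `m ⊗ n ↦ m₍₋₁₎ n₍₋₁₎ ⊗ (m₍₀₎ ⊗ n₍₀₎)`. -/
def tildeCoaction (μ : H ⊗[k] H →ₗ[k] H)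
    (lM : M →ₗ[k] H ⊗[k] M) (lN : N →ₗ[k] H ⊗[k] N) :
    M ⊗[k] N →ₗ[k] H ⊗[k] (M ⊗[k] N) :=
  TensorProduct.map μ LinearMap.id ∘ₗ ttc k H M H N ∘ₗ TensorProduct.map lM lN

/-- Associator `(x ⊗ y) ⊗ z ↦ αX⁻¹(x) ⊗ (y ⊗ αZ(z))`. -/
def aYD {X Z : Type*} [AddCommGroup X] [Module k X] [AddCommGroup Z] [Module k Z]
    (αX : X ≃ₗ[k] X) (Y : Type*) [AddCommGroup Y] [Module k Y] (αZ : Z ≃ₗ[k] Z) :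
    (X ⊗[k] Y) ⊗[k] Z →ₗ[k] X ⊗[k] (Y ⊗[k] Z) :=
  (TensorProduct.assoc k X Y Z).toLinearMap ∘ₗ
    TensorProduct.map (TensorProduct.map αX.symm.toLinearMap LinearMap.id) αZ.toLinearMap

/-- Inverse associator `x ⊗ (y ⊗ z) ↦ (αX(x) ⊗ y) ⊗ αZ⁻¹(z)`. -/
def aYDinv {X Z : Type*} [AddCommGroup X] [Module k X] [AddCommGroup Z] [Module k Z]
    (αX : X ≃ₗ[k] X) (Y : Type*) [AddCommGroup Y] [Module k Y] (αZ : Z ≃ₗ[k] Z) :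
    X ⊗[k] (Y ⊗[k] Z) →ₗ[k] (X ⊗[k] Y) ⊗[k] Z :=
  TensorProduct.map (TensorProduct.map αX.toLinearMap LinearMap.id) αZ.symm.toLinearMap ∘ₗ
    (TensorProduct.assoc k X Y Z).symm.toLinearMap

/-- Associator `(x ⊗ y) ⊗ z ↦ αX(x) ⊗ (y ⊗ αZ⁻¹(z))`. -/
def aTilde {X Z : Type*} [AddCommGroup X] [Module k X] [AddCommGroup Z] [Module k Z]
    (αX : X ≃ₗ[k] X) (Y : Type*) [AddCommGroup Y] [Module k Y] (αZ : Z ≃ₗ[k] Z) :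
    (X ⊗[k] Y) ⊗[k] Z →ₗ[k] X ⊗[k] (Y ⊗[k] Z) :=
  (TensorProduct.assoc k X Y Z).toLinearMap ∘ₗ
    TensorProduct.map (TensorProduct.map αX.toLinearMap LinearMap.id) αZ.symm.toLinearMap

/-- Inverse associator `x ⊗ (y ⊗ z) ↦ (αX⁻¹(x) ⊗ y) ⊗ αZ(z)`. -/
def aTildeInv {X Z : Type*} [AddCommGroup X] [Module k X] [AddCommGroup Z] [Module k Z]
    (αX : X ≃ₗ[k] X) (Y : Type*) [AddCommGroup Y] [Module k Y] (αZ : Z ≃ₗ[k] Z) :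
    X ⊗[k] (Y ⊗[k] Z) →ₗ[k] (X ⊗[k] Y) ⊗[k] Z :=
  TensorProduct.map (TensorProduct.map αX.symm.toLinearMap LinearMap.id) αZ.toLinearMap ∘ₗ
    (TensorProduct.assoc k X Y Z).symm.toLinearMap

/-- Quasitriangular Hom-bialgebra. -/
def IsQuasitriangular (μ : H ⊗[k] H →ₗ[k] H) (Δ : H →ₗ[k] H ⊗[k] H) (α : H →ₗ[k] H)
    (R : H ⊗[k] H) : Prop :=
  IsHomBialgebra k μ Δ α ∧
  TensorProduct.map Δ α R
    = TensorProduct.map (TensorProduct.map α α) μ (ttc k H H H H (R ⊗ₜ[k] R)) ∧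
  TensorProduct.map α Δ R
    = TensorProduct.map μ (TensorProduct.map α α ∘ₗ (TensorProduct.comm k H H).toLinearMap)
        (ttc k H H H H (R ⊗ₜ[k] R)) ∧
  ∀ h : H, TensorProduct.map μ μ (ttc k H H H H ((TensorProduct.comm k H H (Δ h)) ⊗ₜ[k] R))
      = TensorProduct.map μ μ (ttc k H H H H (R ⊗ₜ[k] Δ h))

/-- Coaction induced by an R-matrix: `m ↦ α(R²) ⊗ R¹·m`. -/
def coactionFromR (R : H ⊗[k] H) (α : H →ₗ[k] H) (ρM : H ⊗[k] M →ₗ[k] M) :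
    M →ₗ[k] H ⊗[k] M :=
  (TensorProduct.comm k M H).toLinearMap ∘ₗ TensorProduct.map ρM α ∘ₗ rearr k H H M ∘ₗ
    TensorProduct.mk k (H ⊗[k] H) M R

/-- Quasi-braiding from an R-matrix: `m ⊗ n ↦ αN⁻¹(R²·n) ⊗ αM⁻¹(R¹·m)`. -/
def braidR (R : H ⊗[k] H) (ρM : H ⊗[k] M →ₗ[k] M) (ρN : H ⊗[k] N →ₗ[k] N)
    (αM : M ≃ₗ[k] M) (αN : N ≃ₗ[k] N) : M ⊗[k] N →ₗ[k] N ⊗[k] M :=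
  TensorProduct.map αN.symm.toLinearMap αM.symm.toLinearMap ∘ₗ
    (TensorProduct.comm k M N).toLinearMap ∘ₗ TensorProduct.map ρM ρN ∘ₗ
      ttc k H H M N ∘ₗ TensorProduct.mk k (H ⊗[k] H) (M ⊗[k] N) R

/-- Coquasitriangular Hom-bialgebra. -/
def IsCoquasitriangular (μ : H ⊗[k] H →ₗ[k] H) (Δ : H →ₗ[k] H ⊗[k] H) (α : H →ₗ[k] H)
    (σ : H ⊗[k] H →ₗ[k] k) : Prop :=
  IsHomBialgebra k μ Δ α ∧
  (∀ x y z : H, σ (μ (x ⊗ₜ[k] y) ⊗ₜ[k] α z)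
      = LinearMap.mul' k k
          (TensorProduct.map σ σ (ttc k H H H H ((α x ⊗ₜ[k] α y) ⊗ₜ[k] Δ z)))) ∧
  (∀ x y z : H, σ (α x ⊗ₜ[k] μ (y ⊗ₜ[k] z))
      = LinearMap.mul' k k
          (TensorProduct.map σ σ (ttc k H H H H (Δ x ⊗ₜ[k] (α z ⊗ₜ[k] α y))))) ∧
  (∀ x y : H,
      (TensorProduct.rid k H)
        (TensorProduct.map (μ ∘ₗ (TensorProduct.comm k H H).toLinearMap) σ
          (ttc k H H H H (Δ x ⊗ₜ[k] Δ y)))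
      = (TensorProduct.lid k H)
          (TensorProduct.map σ μ (ttc k H H H H (Δ x ⊗ₜ[k] Δ y))))

/-- Action induced by a coquasitriangular form: `h ⊗ m ↦ σ(m₍₋₁₎ ⊗ α(h)) • m₍₀₎`. -/
def actionFromSigma (σ : H ⊗[k] H →ₗ[k] k) (α : H →ₗ[k] H)
    (lM : M →ₗ[k] H ⊗[k] M) : H ⊗[k] M →ₗ[k] M :=
  (TensorProduct.lid k M).toLinearMap ∘ₗ
    TensorProduct.map (σ ∘ₗ TensorProduct.map LinearMap.id α ∘ₗ
        (TensorProduct.comm k H H).toLinearMap) LinearMap.id ∘ₗ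
      (TensorProduct.assoc k H H M).symm.toLinearMap ∘ₗ
        TensorProduct.map LinearMap.id lM

/-- Quasi-braiding from a coquasitriangular form:
`m ⊗ n ↦ σ(n₍₋₁₎ ⊗ m₍₋₁₎) • (αN⁻¹(n₍₀₎) ⊗ αM⁻¹(m₍₀₎))`. -/
def braidSigma (σ : H ⊗[k] H →ₗ[k] k)
    (lM : M →ₗ[k] H ⊗[k] M) (lN : N →ₗ[k] H ⊗[k] N)
    (αM : M ≃ₗ[k] M) (αN : N ≃ₗ[k] N) : M ⊗[k] N →ₗ[k] N ⊗[k] M :=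
  (TensorProduct.lid k (N ⊗[k] M)).toLinearMap ∘ₗ
    TensorProduct.map (σ ∘ₗ (TensorProduct.comm k H H).toLinearMap)
      (TensorProduct.map αN.symm.toLinearMap αM.symm.toLinearMap ∘ₗ
        (TensorProduct.comm k M N).toLinearMap) ∘ₗ
      ttc k H M H N ∘ₗ TensorProduct.map lM lN


section Pure

variable {k}

@[simp]
theorem ttc_tmul {A B C D : Type*} [AddCommGroup A] [Module k A] [AddCommGroup B] [Module k B]
    [AddCommGroup C] [Module k C] [AddCommGroup D] [Module k D] (a : A) (b : B) (c : C) (d : D) :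
    ttc k A B C D ((a ⊗ₜ b) ⊗ₜ (c ⊗ₜ d)) = (a ⊗ₜ c) ⊗ₜ (b ⊗ₜ d) := rfl

/-- The orbit map `h ↦ h·m`. -/
def orbit (ρ : H ⊗[k] M →ₗ[k] M) (m : M) : H →ₗ[k] M :=
  ρ ∘ₗ (TensorProduct.mk k H M).flip m

@[simp]
theorem orbit_apply (ρ : H ⊗[k] M →ₗ[k] M) (m : M) (h : H) : orbit ρ m h = ρ (h ⊗ₜ m) := rfl

theorem map_ttc_tmul_tmul (ρM : H ⊗[k] M →ₗ[k] M) (ρN : H ⊗[k] N →ₗ[k] N) (T : H ⊗[k] H)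
    (m : M) (n : N) :
    TensorProduct.map ρM ρN (ttc k H H M N (T ⊗ₜ (m ⊗ₜ n)))
      = TensorProduct.map (orbit ρM m) (orbit ρN n) T := by
  induction T with
  | zero => simp
  | tmul a b => simp
  | add T U hT hU => simp [add_tmul, hT, hU]

theorem hatAction_tmul (Δ : H →ₗ[k] H ⊗[k] H) (ρM : H ⊗[k] M →ₗ[k] M)
    (ρN : H ⊗[k] N →ₗ[k] N) (h : H) (m : M) (n : N) :
    hatAction k Δ ρM ρN (h ⊗ₜ (m ⊗ₜ n))
      = TensorProduct.map (orbit ρM m) (orbit ρN n) (Δ h) := by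
  simp [hatAction, map_ttc_tmul_tmul]

section Braid

variable (ρM : H ⊗[k] M →ₗ[k] M) (ρN : H ⊗[k] N →ₗ[k] N) (αM : M ≃ₗ[k] M) (αN : N ≃ₗ[k] N)

@[simp]
theorem braidR_zero : braidR k (0 : H ⊗[k] H) ρM ρN αM αN = 0 := by
  simp [braidR]

@[simp]
theorem braidR_add (T U : H ⊗[k] H) :
    braidR k (T + U) ρM ρN αM αN = braidR k T ρM ρN αM αN + braidR k U ρM ρN αM αN := by
  simp [braidR, LinearMap.comp_add]

@[simp]
theorem braidR_tmul_tmul (a b : H) (m : M) (n : N) :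
    braidR k (a ⊗ₜ b) ρM ρN αM αN (m ⊗ₜ n)
      = αN.symm (ρN (b ⊗ₜ n)) ⊗ₜ αM.symm (ρM (a ⊗ₜ m)) := rfl

end Braid

@[simp]
theorem aYD_tmul {X Y Z : Type*} [AddCommGroup X] [Module k X] [AddCommGroup Y] [Module k Y]
    [AddCommGroup Z] [Module k Z] (αX : X ≃ₗ[k] X) (αZ : Z ≃ₗ[k] Z) (x : X) (y : Y) (z : Z) :
    aYD k αX Y αZ ((x ⊗ₜ y) ⊗ₜ z) = αX.symm x ⊗ₜ (y ⊗ₜ αZ z) := rfl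

@[simp]
theorem aYDinv_tmul {X Y Z : Type*} [AddCommGroup X] [Module k X] [AddCommGroup Y] [Module k Y]
    [AddCommGroup Z] [Module k Z] (αX : X ≃ₗ[k] X) (αZ : Z ≃ₗ[k] Z) (x : X) (y : Y) (z : Z) :
    aYDinv k αX Y αZ (x ⊗ₜ (y ⊗ₜ z)) = (αX x ⊗ₜ y) ⊗ₜ αZ.symm z := rfl

end Pure

namespace IsHomModule

variable {k} {μ : H ⊗[k] H →ₗ[k] H} {αH : H ≃ₗ[k] H} {ρ : H ⊗[k] M →ₗ[k] M} {αM : M ≃ₗ[k] M}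

theorem symm_smul (hM : IsHomModule k μ αH.toLinearMap ρ αM.toLinearMap) (h : H) (m : M) :
    αM.symm (ρ (αH h ⊗ₜ m)) = ρ (h ⊗ₜ αM.symm m) := by
  rw [LinearEquiv.symm_apply_eq]
  simpa using (hM.str_compat h (αM.symm m)).symm

theorem smul_symm_smul (hM : IsHomModule k μ αH.toLinearMap ρ αM.toLinearMap) (h h' : H) (m : M) :
    ρ (h ⊗ₜ αM.symm (ρ (h' ⊗ₜ m))) = αM.symm (ρ (μ (h ⊗ₜ h') ⊗ₜ αM m)) := by
  rw [← hM.symm_smul]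
  exact congrArg αM.symm (hM.hom_smul h h' m)

end IsHomModule

section Identities

variable {k} {P : Type*} [AddCommGroup P] [Module k P]
variable {μ : H ⊗[k] H →ₗ[k] H} {Δ : H →ₗ[k] H ⊗[k] H} {αH : H ≃ₗ[k] H} {R : H ⊗[k] H}
variable {ρM : H ⊗[k] M →ₗ[k] M} {αM : M ≃ₗ[k] M}
variable {ρN : H ⊗[k] N →ₗ[k] N} {αN : N ≃ₗ[k] N}
variable {ρP : H ⊗[k] P →ₗ[k] P} {αP : P ≃ₗ[k] P}

theorem map_braidR (hM : IsHomModule k μ αH.toLinearMap ρM αM.toLinearMap)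
    (hN : IsHomModule k μ αH.toLinearMap ρN αN.toLinearMap) (T : H ⊗[k] H) (m : M) (n : N) :
    TensorProduct.map αN.toLinearMap αM.toLinearMap (braidR k T ρM ρN αM αN (m ⊗ₜ n))
      = braidR k (TensorProduct.map αH.toLinearMap αH.toLinearMap T) ρM ρN αM αN
          (αM m ⊗ₜ αN n) := by
  induction T with
  | zero => simp
  | tmul a b => simp [hM.symm_smul, hN.symm_smul]
  | add T U hT hU => simp [hT, hU]

theorem braidR_map_orbit (hM : IsHomModule k μ αH.toLinearMap ρM αM.toLinearMap)
    (hN : IsHomModule k μ αH.toLinearMap ρN αN.toLinearMap) (T D : H ⊗[k] H) (m : M) (n : N) :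
    braidR k (TensorProduct.map αH.toLinearMap αH.toLinearMap T) ρM ρN αM αN
        (TensorProduct.map (orbit ρM m) (orbit ρN n) D)
      = TensorProduct.comm k M N (TensorProduct.map (αM.symm.toLinearMap ∘ₗ orbit ρM (αM m))
          (αN.symm.toLinearMap ∘ₗ orbit ρN (αN n))
          (TensorProduct.map μ μ (ttc k H H H H (T ⊗ₜ D)))) := by
  have smulM (h h' : H) := hM.hom_smul h h' m
  have smulN (h h' : H) := hN.hom_smul h h' n
  simp only [LinearEquiv.coe_coe] at smulM smulN
  induction T with
  | zero => simp
  | add T U hT hU => simp [hT, hU, add_tmul]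
  | tmul a b =>
    induction D with
    | zero => simp
    | add T U hT hU => simp only [map_add, tmul_add, hT, hU]
    | tmul c d => simp [smulM, smulN]

theorem hatAction_tmul_braidR (hM : IsHomModule k μ αH.toLinearMap ρM αM.toLinearMap)
    (hN : IsHomModule k μ αH.toLinearMap ρN αN.toLinearMap) (h : H) (T : H ⊗[k] H)
    (m : M) (n : N) :
    hatAction k Δ ρN ρM (h ⊗ₜ braidR k T ρM ρN αM αN (m ⊗ₜ n))
      = TensorProduct.comm k M N (TensorProduct.map (αM.symm.toLinearMap ∘ₗ orbit ρM (αM m))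
          (αN.symm.toLinearMap ∘ₗ orbit ρN (αN n))
          (TensorProduct.map μ μ (ttc k H H H H (TensorProduct.comm k H H (Δ h) ⊗ₜ T)))) := by
  induction T with
  | zero => simp
  | add T U hT hU => simp [hT, hU, tmul_add]
  | tmul a b =>
    rw [braidR_tmul_tmul, hatAction_tmul]
    induction Δ h with
    | zero => simp
    | add T U hT hU => simp only [map_add, add_tmul, hT, hU]
    | tmul c d => simp [hM.smul_symm_smul, hN.smul_symm_smul]

/-- `a ⊗ (b ⊗ c) ↦ αN⁻²(b·n) ⊗ (αP⁻¹(c·αP(p)) ⊗ αM⁻¹(a·m))`. -/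
def hexagonEval (ρM : H ⊗[k] M →ₗ[k] M) (αM : M ≃ₗ[k] M) (ρN : H ⊗[k] N →ₗ[k] N)
    (αN : N ≃ₗ[k] N) (ρP : H ⊗[k] P →ₗ[k] P) (αP : P ≃ₗ[k] P) (m : M) (n : N) (p : P) :
    H ⊗[k] (H ⊗[k] H) →ₗ[k] N ⊗[k] (P ⊗[k] M) :=
  (TensorProduct.assoc k N P M).toLinearMap ∘ₗ (TensorProduct.comm k M (N ⊗[k] P)).toLinearMap ∘ₗ
    TensorProduct.map (αM.symm.toLinearMap ∘ₗ orbit ρM m)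
      (TensorProduct.map (αN.symm.toLinearMap ∘ₗ αN.symm.toLinearMap ∘ₗ orbit ρN n)
        (αP.symm.toLinearMap ∘ₗ orbit ρP (αP p)))

theorem hexagonEval_comul (hM : IsHomModule k μ αH.toLinearMap ρM αM.toLinearMap)
    (T : H ⊗[k] H) (m : M) (n : N) (p : P) :
    aYD k αN P αM (braidR k T ρM (hatAction k Δ ρN ρP) αM (TensorProduct.congr αN αP)
        (αM.symm m ⊗ₜ (n ⊗ₜ αP p)))
      = hexagonEval ρM αM ρN αN ρP αP m n p (TensorProduct.map αH.toLinearMap Δ T) := by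
  induction T with
  | zero => simp
  | add T U hT hU => simp [hT, hU]
  | tmul a b =>
    rw [braidR_tmul_tmul, hatAction_tmul, TensorProduct.map_tmul]
    induction Δ b with
    | zero => simp
    | add T U hT hU => simp only [map_add, tmul_add, add_tmul, hT, hU]
    | tmul c d => simp [hexagonEval, hM.symm_smul, TensorProduct.congr_symm_tmul]

theorem hexagonEval_mul (hM : IsHomModule k μ αH.toLinearMap ρM αM.toLinearMap) (T U : H ⊗[k] H)
    (m : M) (n : N) (p : P) :
    TensorProduct.map (LinearMap.id : N →ₗ[k] N)
        (braidR k (TensorProduct.map αH.toLinearMap αH.toLinearMap T) ρM ρP αM αP)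
        (aYD k αN M αP
          (braidR k (TensorProduct.map αH.toLinearMap αH.toLinearMap U) ρM ρN αM αN (m ⊗ₜ n)
            ⊗ₜ p))
      = hexagonEval ρM αM ρN αN ρP αP m n p
          (TensorProduct.map μ (TensorProduct.map αH.toLinearMap αH.toLinearMap ∘ₗ
            (TensorProduct.comm k H H).toLinearMap) (ttc k H H H H (T ⊗ₜ U))) := by
  induction T with
  | zero => simp
  | add T T' hT hT' =>
    simp only [map_add, braidR_add, add_tmul, TensorProduct.map_add_right, LinearMap.add_apply,
      hT, hT']
  | tmul a b =>
    induction U with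
    | zero => simp
    | add U U' hU hU' =>
      simp only [map_add, braidR_add, tmul_add, add_tmul, LinearMap.add_apply, hU, hU']
    | tmul c d =>
      simp [hexagonEval, hM.smul_symm_smul, hM.symm_smul]

/-- `(a ⊗ b) ⊗ c ↦ (αP⁻¹(c·p) ⊗ αM⁻¹(a·αM(m))) ⊗ αN⁻²(b·n)`. -/
def hexagonInvEval (ρM : H ⊗[k] M →ₗ[k] M) (αM : M ≃ₗ[k] M) (ρN : H ⊗[k] N →ₗ[k] N)
    (αN : N ≃ₗ[k] N) (ρP : H ⊗[k] P →ₗ[k] P) (αP : P ≃ₗ[k] P) (m : M) (n : N) (p : P) :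
    (H ⊗[k] H) ⊗[k] H →ₗ[k] (P ⊗[k] M) ⊗[k] N :=
  (TensorProduct.assoc k P M N).symm.toLinearMap ∘ₗ
    (TensorProduct.comm k (M ⊗[k] N) P).toLinearMap ∘ₗ
      TensorProduct.map (TensorProduct.map (αM.symm.toLinearMap ∘ₗ orbit ρM (αM m))
        (αN.symm.toLinearMap ∘ₗ αN.symm.toLinearMap ∘ₗ orbit ρN n))
        (αP.symm.toLinearMap ∘ₗ orbit ρP p)

theorem hexagonInvEval_comul (hP : IsHomModule k μ αH.toLinearMap ρP αP.toLinearMap)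
    (T : H ⊗[k] H) (m : M) (n : N) (p : P) :
    aYDinv k αP M αN (braidR k T (hatAction k Δ ρM ρN) ρP (TensorProduct.congr αM αN) αP
        ((αM m ⊗ₜ n) ⊗ₜ αP.symm p))
      = hexagonInvEval ρM αM ρN αN ρP αP m n p (TensorProduct.map Δ αH.toLinearMap T) := by
  induction T with
  | zero => simp
  | add T U hT hU => simp [hT, hU]
  | tmul a b =>
    rw [braidR_tmul_tmul, hatAction_tmul, TensorProduct.map_tmul]
    induction Δ a with
    | zero => simp
    | add T U hT hU => simp only [map_add, tmul_add, add_tmul, hT, hU]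
    | tmul c d => simp [hexagonInvEval, hP.symm_smul, TensorProduct.congr_symm_tmul]

theorem hexagonInvEval_mul (hP : IsHomModule k μ αH.toLinearMap ρP αP.toLinearMap) (T U : H ⊗[k] H)
    (m : M) (n : N) (p : P) :
    TensorProduct.map
        (braidR k (TensorProduct.map αH.toLinearMap αH.toLinearMap T) ρM ρP αM αP)
        (LinearMap.id : N →ₗ[k] N)
        (aYDinv k αM P αN (m ⊗ₜ
          braidR k (TensorProduct.map αH.toLinearMap αH.toLinearMap U) ρN ρP αN αP (n ⊗ₜ p)))
      = hexagonInvEval ρM αM ρN αN ρP αP m n p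
          (TensorProduct.map (TensorProduct.map αH.toLinearMap αH.toLinearMap) μ
            (ttc k H H H H (T ⊗ₜ U))) := by
  induction T with
  | zero => simp
  | add T T' hT hT' =>
    simp only [map_add, braidR_add, add_tmul, TensorProduct.map_add_left, LinearMap.add_apply,
      hT, hT']
  | tmul a b =>
    induction U with
    | zero => simp
    | add U U' hU hU' =>
      simp only [map_add, braidR_add, tmul_add, LinearMap.add_apply, hU, hU']
    | tmul c d =>
      simp [hexagonInvEval, hP.smul_symm_smul, hP.symm_smul]

/-- `(a ⊗ b) ⊗ c ↦ αP⁻²(αH(c)·αP(p)) ⊗ (αN⁻²(b·αN(n)) ⊗ αM⁻²(a·αM(m)))`. -/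
def yangBaxterEval (αH : H ≃ₗ[k] H) (ρM : H ⊗[k] M →ₗ[k] M) (αM : M ≃ₗ[k] M)
    (ρN : H ⊗[k] N →ₗ[k] N) (αN : N ≃ₗ[k] N) (ρP : H ⊗[k] P →ₗ[k] P) (αP : P ≃ₗ[k] P)
    (m : M) (n : N) (p : P) :
    (H ⊗[k] H) ⊗[k] H →ₗ[k] P ⊗[k] (N ⊗[k] M) :=
  (TensorProduct.comm k (N ⊗[k] M) P).toLinearMap ∘ₗ
    TensorProduct.map ((TensorProduct.comm k M N).toLinearMap ∘ₗ TensorProduct.map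
        (αM.symm.toLinearMap ∘ₗ αM.symm.toLinearMap ∘ₗ orbit ρM (αM m))
        (αN.symm.toLinearMap ∘ₗ αN.symm.toLinearMap ∘ₗ orbit ρN (αN n)))
      (αP.symm.toLinearMap ∘ₗ αP.symm.toLinearMap ∘ₗ orbit ρP (αP p) ∘ₗ αH.toLinearMap)

/-- The componentwise product `T ↦ S·T` on `H ⊗ H`. -/
def mulLeftTensor (μ : H ⊗[k] H →ₗ[k] H) (S : H ⊗[k] H) : H ⊗[k] H →ₗ[k] H ⊗[k] H :=
  TensorProduct.map μ μ ∘ₗ ttc k H H H H ∘ₗ TensorProduct.mk k (H ⊗[k] H) (H ⊗[k] H) S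

/-- The componentwise product `T ↦ T₂₁·S` on `H ⊗ H`. -/
def flipMulRightTensor (μ : H ⊗[k] H →ₗ[k] H) (S : H ⊗[k] H) : H ⊗[k] H →ₗ[k] H ⊗[k] H :=
  TensorProduct.map μ μ ∘ₗ ttc k H H H H ∘ₗ
    (TensorProduct.mk k (H ⊗[k] H) (H ⊗[k] H)).flip S ∘ₗ (TensorProduct.comm k H H).toLinearMap

theorem mulLeftTensor_comul (hQT : IsQuasitriangular k μ Δ αH.toLinearMap R) :
    mulLeftTensor μ R ∘ₗ Δ = flipMulRightTensor μ R ∘ₗ Δ :=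
  LinearMap.ext fun h => (hQT.2.2.2 h).symm

section Linear

variable (μ) (S S' : H ⊗[k] H)

@[simp]
theorem mulLeftTensor_zero : mulLeftTensor μ (0 : H ⊗[k] H) = 0 := by simp [mulLeftTensor]

@[simp]
theorem mulLeftTensor_add :
    mulLeftTensor μ (S + S') = mulLeftTensor μ S + mulLeftTensor μ S' := by
  simp [mulLeftTensor, LinearMap.comp_add]

@[simp]
theorem mulLeftTensor_tmul (a b c d : H) :
    mulLeftTensor μ (a ⊗ₜ b) (c ⊗ₜ d) = μ (a ⊗ₜ c) ⊗ₜ[k] μ (b ⊗ₜ d) := rfl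

@[simp]
theorem flipMulRightTensor_zero : flipMulRightTensor μ (0 : H ⊗[k] H) = 0 := by
  simp [flipMulRightTensor]

@[simp]
theorem flipMulRightTensor_add :
    flipMulRightTensor μ (S + S') = flipMulRightTensor μ S + flipMulRightTensor μ S' := by
  simp [flipMulRightTensor, LinearMap.comp_add, LinearMap.add_comp]

@[simp]
theorem flipMulRightTensor_tmul (a b c d : H) :
    flipMulRightTensor μ (a ⊗ₜ b) (c ⊗ₜ d) = μ (d ⊗ₜ a) ⊗ₜ[k] μ (c ⊗ₜ b) := rfl

end Linear

theorem yangBaxterEval_mulLeftTensor (hH : IsHomBialgebra k μ Δ αH.toLinearMap)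
    (hM : IsHomModule k μ αH.toLinearMap ρM αM.toLinearMap)
    (hN : IsHomModule k μ αH.toLinearMap ρN αN.toLinearMap)
    (hP : IsHomModule k μ αH.toLinearMap ρP αP.toLinearMap)
    (S T U : H ⊗[k] H) (m : M) (n : N) (p : P) :
    TensorProduct.map (LinearMap.id : P →ₗ[k] P) (braidR k S ρM ρN αM αN)
      (TensorProduct.assoc k P M N
        (TensorProduct.map
          (braidR k (TensorProduct.map αH.toLinearMap αH.toLinearMap T) ρM ρP αM αP)
          (LinearMap.id : N →ₗ[k] N)
          ((TensorProduct.assoc k M P N).symm (m ⊗ₜ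
            braidR k (TensorProduct.map αH.toLinearMap αH.toLinearMap U) ρN ρP αN αP
              (n ⊗ₜ p)))))
      = yangBaxterEval αH ρM αM ρN αN ρP αP m n p
          (TensorProduct.map (mulLeftTensor μ S) LinearMap.id
            (TensorProduct.map (TensorProduct.map αH.toLinearMap αH.toLinearMap) μ
              (ttc k H H H H (T ⊗ₜ U)))) := by
  have mul_mult (a b : H) : μ (αH a ⊗ₜ[k] αH b) = αH (μ (a ⊗ₜ[k] b)) := (hH.mul_mult a b).symm
  induction S with
  | zero => simp
  | add S S' hS hS' =>
    simp only [map_add, braidR_add, mulLeftTensor_add, TensorProduct.map_add_left,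
      TensorProduct.map_add_right, LinearMap.add_apply, hS, hS']
  | tmul s t =>
    induction T with
    | zero => simp
    | add T T' hT hT' =>
      simp only [map_add, braidR_add, add_tmul, TensorProduct.map_add_left, LinearMap.add_apply,
        hT, hT']
    | tmul a b =>
      induction U with
      | zero => simp
      | add U U' hU hU' =>
        simp only [map_add, braidR_add, tmul_add, LinearMap.add_apply, hU, hU']
      | tmul c d =>
        simp [yangBaxterEval, hM.smul_symm_smul, hN.smul_symm_smul, hP.smul_symm_smul, mul_mult]

theorem yangBaxterEval_flipMulRightTensor (hH : IsHomBialgebra k μ Δ αH.toLinearMap)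
    (hM : IsHomModule k μ αH.toLinearMap ρM αM.toLinearMap)
    (hN : IsHomModule k μ αH.toLinearMap ρN αN.toLinearMap)
    (hP : IsHomModule k μ αH.toLinearMap ρP αP.toLinearMap)
    (S T U : H ⊗[k] H) (m : M) (n : N) (p : P) :
    TensorProduct.assoc k P N M
      (TensorProduct.map
        (braidR k (TensorProduct.map αH.toLinearMap αH.toLinearMap T) ρN ρP αN αP)
        (LinearMap.id : M →ₗ[k] M)
        ((TensorProduct.assoc k N P M).symm
          (TensorProduct.map (LinearMap.id : N →ₗ[k] N)
            (braidR k (TensorProduct.map αH.toLinearMap αH.toLinearMap U) ρM ρP αM αP)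
            (TensorProduct.assoc k N M P (braidR k S ρM ρN αM αN (m ⊗ₜ n) ⊗ₜ p)))))
      = yangBaxterEval αH ρM αM ρN αN ρP αP m n p
          (TensorProduct.map (flipMulRightTensor μ S) LinearMap.id
            (TensorProduct.map (TensorProduct.map αH.toLinearMap αH.toLinearMap) μ
              (ttc k H H H H (T ⊗ₜ U)))) := by
  have mul_mult (a b : H) : μ (αH a ⊗ₜ[k] αH b) = αH (μ (a ⊗ₜ[k] b)) := (hH.mul_mult a b).symm
  induction S with
  | zero => simp
  | add S S' hS hS' =>
    simp only [map_add, braidR_add, flipMulRightTensor_add, add_tmul, TensorProduct.map_add_left,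
      LinearMap.add_apply, hS, hS']
  | tmul s t =>
    induction T with
    | zero => simp
    | add T T' hT hT' =>
      simp only [map_add, braidR_add, add_tmul, TensorProduct.map_add_left, LinearMap.add_apply,
        hT, hT']
    | tmul a b =>
      induction U with
      | zero => simp
      | add U U' hU hU' =>
        simp only [map_add, braidR_add, tmul_add, TensorProduct.map_add_right,
          LinearMap.add_apply, hU, hU']
      | tmul c d =>
        simp [yangBaxterEval, hM.smul_symm_smul, hN.smul_symm_smul, hP.smul_symm_smul, mul_mult]

end Identities


/-- for modules over a quasitriangular Hom-bialgebra (with `αH` bijective and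
`(α ⊗ α)(R) = R`), the maps `c_{X,Y}(x⊗y) = αY⁻¹(R²·y) ⊗ αX⁻¹(R¹·x)` commute with the
structure maps, are H-linear, satisfy the braid relation and the two hexagon relations. -/
theorem stmt13 {k H M N P : Type*} [Field k]
    [AddCommGroup H] [Module k H] [AddCommGroup M] [Module k M]
    [AddCommGroup N] [Module k N] [AddCommGroup P] [Module k P]
    (μ : H ⊗[k] H →ₗ[k] H) (Δ : H →ₗ[k] H ⊗[k] H) (αH : H ≃ₗ[k] H) (R : H ⊗[k] H)
    (hQT : IsQuasitriangular k μ Δ αH.toLinearMap R)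
    (hR : TensorProduct.map αH.toLinearMap αH.toLinearMap R = R)
    (ρM : H ⊗[k] M →ₗ[k] M) (αM : M ≃ₗ[k] M)
    (hM : IsHomModule k μ αH.toLinearMap ρM αM.toLinearMap)
    (ρN : H ⊗[k] N →ₗ[k] N) (αN : N ≃ₗ[k] N)
    (hN : IsHomModule k μ αH.toLinearMap ρN αN.toLinearMap)
    (ρP : H ⊗[k] P →ₗ[k] P) (αP : P ≃ₗ[k] P)
    (hP : IsHomModule k μ αH.toLinearMap ρP αP.toLinearMap) :
    (TensorProduct.map αN.toLinearMap αM.toLinearMap ∘ₗ braidR k R ρM ρN αM αN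
      = braidR k R ρM ρN αM αN ∘ₗ TensorProduct.map αM.toLinearMap αN.toLinearMap) ∧
    (braidR k R ρM ρN αM αN ∘ₗ hatAction k Δ ρM ρN
      = hatAction k Δ ρN ρM ∘ₗ
          TensorProduct.map (LinearMap.id : H →ₗ[k] H) (braidR k R ρM ρN αM αN)) ∧
    (TensorProduct.map (LinearMap.id : P →ₗ[k] P) (braidR k R ρM ρN αM αN) ∘ₗ
        (TensorProduct.assoc k P M N).toLinearMap ∘ₗ
          TensorProduct.map (braidR k R ρM ρP αM αP) (LinearMap.id : N →ₗ[k] N) ∘ₗ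
            (TensorProduct.assoc k M P N).symm.toLinearMap ∘ₗ
              TensorProduct.map (LinearMap.id : M →ₗ[k] M) (braidR k R ρN ρP αN αP)
      = (TensorProduct.assoc k P N M).toLinearMap ∘ₗ
          TensorProduct.map (braidR k R ρN ρP αN αP) (LinearMap.id : M →ₗ[k] M) ∘ₗ
            (TensorProduct.assoc k N P M).symm.toLinearMap ∘ₗ
              TensorProduct.map (LinearMap.id : N →ₗ[k] N) (braidR k R ρM ρP αM αP) ∘ₗ
                (TensorProduct.assoc k N M P).toLinearMap ∘ₗ
                  TensorProduct.map (braidR k R ρM ρN αM αN) (LinearMap.id : P →ₗ[k] P) ∘ₗ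
                    (TensorProduct.assoc k M N P).symm.toLinearMap) ∧
    (aYD k αN P αM ∘ₗ
        braidR k R ρM (hatAction k Δ ρN ρP) αM (TensorProduct.congr αN αP) ∘ₗ
          aYD k αM N αP
      = TensorProduct.map (LinearMap.id : N →ₗ[k] N) (braidR k R ρM ρP αM αP) ∘ₗ
          aYD k αN M αP ∘ₗ
            TensorProduct.map (braidR k R ρM ρN αM αN) (LinearMap.id : P →ₗ[k] P)) ∧
    (aYDinv k αP M αN ∘ₗ
        braidR k R (hatAction k Δ ρM ρN) ρP (TensorProduct.congr αM αN) αP ∘ₗ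
          aYDinv k αM N αP
      = TensorProduct.map (braidR k R ρM ρP αM αP) (LinearMap.id : N →ₗ[k] N) ∘ₗ
          aYDinv k αM P αN ∘ₗ
            TensorProduct.map (LinearMap.id : M →ₗ[k] M) (braidR k R ρN ρP αN αP)) := by
  have hH := hQT.1
  refine ⟨?_, ?_, ?_, ?_, ?_⟩
  · refine TensorProduct.ext' fun m n => ?_
    simpa [hR] using map_braidR hM hN R m n
  · refine TensorProduct.ext_threefold' fun h m n => ?_
    have key := braidR_map_orbit hM hN R (Δ h) m n
    rw [hR, ← hQT.2.2.2 h, ← hatAction_tmul_braidR hM hN] at key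
    simpa [hatAction_tmul] using key
  · refine TensorProduct.ext_threefold' fun m n p => ?_
    have left := yangBaxterEval_mulLeftTensor hH hM hN hP R R R m n p
    have right := yangBaxterEval_flipMulRightTensor hH hM hN hP R R R m n p
    rw [hR, ← hQT.2.1, ← LinearMap.comp_apply (TensorProduct.map _ _), ← TensorProduct.map_comp]
      at left right
    rw [mulLeftTensor_comul hQT] at left
    simpa using left.trans right.symm
  · refine TensorProduct.ext_threefold fun m n p => ?_
    have left := hexagonEval_comul
      (Δ := Δ) (ρN := ρN) (αN := αN) (ρP := ρP) (αP := αP) hM R m n p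
    have right := hexagonEval_mul (ρN := ρN) (αN := αN) (ρP := ρP) (αP := αP) hM R R m n p
    rw [hR, ← hQT.2.2.1] at right
    simpa using left.trans right.symm
  · refine TensorProduct.ext_threefold' fun m n p => ?_
    have left := hexagonInvEval_comul
      (Δ := Δ) (ρM := ρM) (αM := αM) (ρN := ρN) (αN := αN) hP R m n p
    have right := hexagonInvEval_mul (ρM := ρM) (αM := αM) (ρN := ρN) (αN := αN) hP R R m n p
    rw [hR, ← hQT.2.1] at right
    simpa using left.trans right.symm


end HomYD
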